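/- There exists a constant c > 0 such that for all integers n1, n2 ≥ 1, (n1+n2)·H_{n1+n2} − n1·H_{n1} − n2·H_{n2} ≥ c · ln( binomial(n1+n2, n1) ). -/

import Mathlib

open MeasureTheory Finset

attribute [local instance] Classical.propDecidable

noncomputable def harm (q : ℕ) : ℝ := ∑ m ∈ Finset.range q, (1 : ℝ) / (m + 1)

noncomputable def linExts (α : Type) [Fintype α] (r : α → α → Prop) :
    Finset (α ≃ Fin (Fintype.card α)) :=
  Finset.univ.filter fun σ => ∀ i j : α, r i j → σ i ≤ σ j

noncomputable def dN {α : Type} [Fintype α] (r : α → α → Prop)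
    (σ : α ≃ Fin (Fintype.card α)) (i : α) : ℕ :=
  if ∀ j : α, r j i → j = i then (σ i : ℕ) + 1
  else sInf {m : ℕ | ∃ j : α, j ≠ i ∧ r j i ∧ m = (σ i : ℕ) - (σ j : ℕ)}

noncomputable def QLB (α : Type) [Fintype α] (r : α → α → Prop) : ℝ :=
  (∑ σ ∈ linExts α r, ∑ i : α, harm (dN r σ i - 1)) / ((linExts α r).card : ℝ)

def chainPolytope (α : Type) [Fintype α] (r : α → α → Prop) : Set (α → ℝ) :=
  {y | (∀ i, 0 ≤ y i) ∧
    ∀ C : Finset α, (∀ i ∈ C, ∀ j ∈ C, r i j ∨ r j i) → ∑ i ∈ C, y i ≤ 1}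

def orderPolytope (α : Type) [Fintype α] (r : α → α → Prop) : Set (α → ℝ) :=
  {y | (∀ i, 0 ≤ y i ∧ y i ≤ 1) ∧ ∀ i j : α, r i j → y i ≤ y j}

noncomputable def transferMap (α : Type) [Fintype α] (r : α → α → Prop)
    (y : α → ℝ) (i : α) : ℝ :=
  if ∀ j : α, r j i → j = i then y i
  else sInf {t : ℝ | ∃ j : α, j ≠ i ∧ r j i ∧ t = y i - y j}

noncomputable def QH (α : Type) [Fintype α] (r : α → α → Prop) : ℝ :=
  ⨍ z in chainPolytope α r, -(1 / (Fintype.card α : ℝ)) * ∑ i : α, Real.log (z i)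

noncomputable def posetEntropy (α : Type) [Fintype α] (r : α → α → Prop) : ℝ :=
  sInf {x : ℝ | ∃ z ∈ chainPolytope α r, (∀ i, 0 < z i) ∧
    x = -(1 / (Fintype.card α : ℝ)) * ∑ i : α, Real.log (z i)}

def seriesComp {α β : Type} (r : α → α → Prop) (s : β → β → Prop) :
    α ⊕ β → α ⊕ β → Prop
  | Sum.inl x, Sum.inl y => r x y
  | Sum.inr x, Sum.inr y => s x y
  | Sum.inl _, Sum.inr _ => True
  | Sum.inr _, Sum.inl _ => False

def parallelComp {α β : Type} (r : α → α → Prop) (s : β → β → Prop) :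
    α ⊕ β → α ⊕ β → Prop
  | Sum.inl x, Sum.inl y => r x y
  | Sum.inr x, Sum.inr y => s x y
  | _, _ => False

lemma harm_succ (q : ℕ) : harm (q + 1) = harm q + 1 / ((q : ℝ) + 1) := by
  simp [harm, Finset.sum_range_succ]

lemma log_sub_log_le_harm_sub_harm (n m : ℕ) :
    Real.log ((n : ℝ) + m + 1) - Real.log ((m : ℝ) + 1) ≤ harm (n + m) - harm m := by
  induction n with
  | zero => simp
  | succ n ih =>
    have hpos : (0 : ℝ) < (n : ℝ) + m + 1 := by positivity
    have hlog := Real.log_le_sub_one_of_pos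
      (show (0 : ℝ) < ((n : ℝ) + m + 1 + 1) / ((n : ℝ) + m + 1) by positivity)
    rw [Real.log_div (by positivity) hpos.ne', add_div, div_self hpos.ne'] at hlog
    rw [show n + 1 + m = (n + m) + 1 by ring, harm_succ]
    push_cast
    rw [show (n : ℝ) + 1 + m + 1 = n + m + 1 + 1 by ring]
    linarith

lemma log_choose_succ (n m : ℕ) :
    Real.log ((n + (m + 1)).choose n : ℕ) =
      Real.log ((n + m).choose n : ℕ) +
        (Real.log ((n : ℝ) + m + 1) - Real.log ((m : ℝ) + 1)) := by
  have h := Nat.choose_mul_succ_eq (n + m) n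
  rw [show n + m + 1 - n = m + 1 by omega] at h
  have hR : ((n + m).choose n : ℝ) * ((n : ℝ) + m + 1) =
      ((n + (m + 1)).choose n : ℝ) * ((m : ℝ) + 1) := by
    exact_mod_cast h
  have h₁ : ((n + m).choose n : ℝ) ≠ 0 :=
    Nat.cast_ne_zero.mpr (Nat.choose_pos (by omega)).ne'
  have h₂ : ((n + (m + 1)).choose n : ℝ) ≠ 0 :=
    Nat.cast_ne_zero.mpr (Nat.choose_pos (by omega)).ne'
  have hlog := congrArg Real.log hR
  rw [Real.log_mul h₁ (by positivity), Real.log_mul h₂ (by positivity)] at hlog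
  linarith

lemma succ_mul_harm_succ (q : ℕ) :
    ((q : ℝ) + 1) * harm (q + 1) = (q : ℝ) * harm q + harm q + 1 := by
  rw [harm_succ]
  field_simp

lemma log_choose_le_harm (n m : ℕ) :
    Real.log ((n + m).choose n : ℕ) ≤
      ((n + m : ℕ) : ℝ) * harm (n + m) - (n : ℝ) * harm n - (m : ℝ) * harm m := by
  induction m with
  | zero => simp
  | succ m ih =>
    have h₁ := log_sub_log_le_harm_sub_harm n m
    have h₂ := succ_mul_harm_succ (n + m)
    have h₃ := succ_mul_harm_succ m
    rw [log_choose_succ, ← add_assoc, Nat.cast_succ, Nat.cast_succ]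
    linarith

/-- There is `c > 0` with
`(n1+n2) H_{n1+n2} − n1 H_{n1} − n2 H_{n2} ≥ c ln (binom(n1+n2, n1))` for all `n1, n2 ≥ 1`. -/
theorem stmt_9 : ∃ c : ℝ, 0 < c ∧ ∀ n1 n2 : ℕ, 1 ≤ n1 → 1 ≤ n2 →
    c * Real.log (((n1 + n2).choose n1 : ℕ)) ≤
      ((n1 + n2 : ℕ) : ℝ) * harm (n1 + n2) - (n1 : ℝ) * harm n1 - (n2 : ℝ) * harm n2 := by
  exact ⟨1, one_pos, fun n1 n2 _ _ => by simpa only [one_mul] using log_choose_le_harm n1 n2⟩
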